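/- For any family (t_{abc}) of nonzero real numbers indexed by the integers a, b, c ≥ 1 with a + b + c = n, there exists a generic flag triple (E,F,G) in ℝ^n such that T_{abc}(E,F,G) = t_{abc} for every such a, b, c. -/

import Mathlib

open Module

/-- A flag in `ℝⁿ`: a family of nested linear subspaces `F⁰ ⊆ F¹ ⊆ ⋯ ⊆ Fⁿ`
where each `Fᵃ` has dimension `a`. -/
structure FlagRn (n : ℕ) where
  space : ℕ → Submodule ℝ (Fin n → ℝ)
  mono : ∀ a b : ℕ, a ≤ b → b ≤ n → space a ≤ space b
  finrank_eq : ∀ a : ℕ, a ≤ n → Module.finrank ℝ (space a) = a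

/-- A pair of flags `(E, F)` in `ℝⁿ` is generic if `Eᵃ ∩ Fⁿ⁻ᵃ = 0` for every `0 ≤ a ≤ n`. -/
def GenericPair (n : ℕ) (E F : FlagRn n) : Prop :=
  ∀ a : ℕ, a ≤ n → E.space a ⊓ F.space (n - a) = ⊥

/-- A triple of flags `(E, F, G)` in `ℝⁿ` is generic if each pair among them is generic and
`Eᵃ ∩ Fᵇ ∩ Gᶜ = 0` whenever `a + b + c = n`. -/
def GenericTriple (n : ℕ) (E F G : FlagRn n) : Prop :=
  GenericPair n E F ∧ GenericPair n F G ∧ GenericPair n E G ∧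
    ∀ a b c : ℕ, a + b + c = n → E.space a ⊓ F.space b ⊓ G.space c = ⊥

/-- The wedge product `v 0 ∧ v 1 ∧ ⋯ ∧ v (k-1)` in the exterior algebra of `ℝⁿ`. -/
noncomputable def wedge {n k : ℕ} (v : Fin k → (Fin n → ℝ)) :
    ExteriorAlgebra ℝ (Fin n → ℝ) :=
  (List.ofFn fun i => ExteriorAlgebra.ι ℝ (v i)).prod

/-- `Λᵏ(W)` for a subspace `W ⊆ ℝⁿ`, realized as the subspace of the exterior algebra of `ℝⁿ`
spanned by the wedge products of `k`-tuples of vectors of `W`. -/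
noncomputable def lambdaPow {n : ℕ} (k : ℕ) (W : Submodule ℝ (Fin n → ℝ)) :
    Submodule ℝ (ExteriorAlgebra ℝ (Fin n → ℝ)) :=
  Submodule.span ℝ {ω | ∃ v : Fin k → (Fin n → ℝ), (∀ i, v i ∈ W) ∧ ω = wedge v}

/-- The ratio `ω / ω'` of two elements of the one-dimensional space `Λⁿ(ℝⁿ)`:
the unique real number `r` with `ω = r • ω'` (when `ω' ≠ 0` and both lie in `Λⁿ(ℝⁿ)`). -/
noncomputable def topRatio {n : ℕ} (ω ω' : ExteriorAlgebra ℝ (Fin n → ℝ)) : ℝ :=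
  letI := Classical.dec (∃ r : ℝ, ω = r • ω')
  if h : ∃ r : ℝ, ω = r • ω' then h.choose else 0

/-- A choice of nonzero element of `Λᵏ(Eᵏ)`: the wedge product of (a choice of) basis
of the `k`-dimensional subspace `Eᵏ` of the flag `E`. -/
noncomputable def flagWedge {n : ℕ} (E : FlagRn n) (k : ℕ) : ExteriorAlgebra ℝ (Fin n → ℝ) :=
  letI := Classical.dec (∃ v : Fin k → (Fin n → ℝ), (∀ i, v i ∈ E.space k) ∧ LinearIndependent ℝ v)
  if h : ∃ v : Fin k → (Fin n → ℝ), (∀ i, v i ∈ E.space k) ∧ LinearIndependent ℝ v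
  then wedge h.choose else 0

/-- The triple ratio `T_{abc}(E, F, G)` of a (generic) flag triple. -/
noncomputable def tripleRatio {n : ℕ} (a b c : ℕ) (E F G : FlagRn n) : ℝ :=
  topRatio (flagWedge E (a + 1) * flagWedge F b * flagWedge G (c - 1))
      (flagWedge E (a - 1) * flagWedge F b * flagWedge G (c + 1)) *
    topRatio (flagWedge E a * flagWedge F (b - 1) * flagWedge G (c + 1))
      (flagWedge E a * flagWedge F (b + 1) * flagWedge G (c - 1)) *
    topRatio (flagWedge E (a - 1) * flagWedge F (b + 1) * flagWedge G c)
      (flagWedge E (a + 1) * flagWedge F (b - 1) * flagWedge G c)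

/-- The `a`-th quadruple ratio `Q_a(E, F, G)` of a (generic) flag triple. -/
noncomputable def quadrupleRatio {n : ℕ} (a : ℕ) (E F G : FlagRn n) : ℝ :=
  topRatio (flagWedge E (a - 1) * flagWedge F (n - a) * flagWedge G 1)
      (flagWedge E a * flagWedge F (n - a - 1) * flagWedge G 1) *
    topRatio (flagWedge E a * flagWedge F 1 * flagWedge G (n - a - 1))
      (flagWedge E (a - 1) * flagWedge F 1 * flagWedge G (n - a)) *
    topRatio (flagWedge E (a + 1) * flagWedge F (n - a - 1))
      (flagWedge E (a + 1) * flagWedge G (n - a - 1)) *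
    topRatio (flagWedge E a * flagWedge G (n - a))
      (flagWedge E a * flagWedge F (n - a))

/-- The `a`-th double ratio `D_a(E, F, G, G')` of a (generic) flag quadruple. -/
noncomputable def doubleRatio {n : ℕ} (a : ℕ) (E F G G' : FlagRn n) : ℝ :=
  -(topRatio (flagWedge E a * flagWedge F (n - a - 1) * flagWedge G 1)
        (flagWedge E a * flagWedge F (n - a - 1) * flagWedge G' 1) *
      topRatio (flagWedge E (a - 1) * flagWedge F (n - a) * flagWedge G' 1)
        (flagWedge E (a - 1) * flagWedge F (n - a) * flagWedge G 1))

/-- The image of a flag under a linear automorphism of `ℝⁿ`. -/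
def FlagRn.map {n : ℕ} (φ : (Fin n → ℝ) ≃ₗ[ℝ] (Fin n → ℝ)) (E : FlagRn n) : FlagRn n where
  space k := (E.space k).map (φ : (Fin n → ℝ) →ₗ[ℝ] (Fin n → ℝ))
  mono a b hab hb := Submodule.map_mono (E.mono a b hab hb)
  finrank_eq a ha := by
    rw [LinearEquiv.finrank_map_eq]
    exact E.finrank_eq a ha

/-- An alternating map in as many variables as the size of a basis is determined by its value on
that basis. -/
lemma AlternatingMap.apply_eq_basis_det_smul {R M N ι : Type*} [CommRing R] [AddCommGroup M]
    [Module R M] [AddCommGroup N] [Module R N] [Fintype ι] [DecidableEq ι]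
    (e : Basis ι R M) (f : M [⋀^ι]→ₗ[R] N) (v : ι → M) : f v = e.det v • f e := by
  suffices h : f = (LinearMap.toSpanSingleton R N (f e)).compAlternatingMap e.det by
    conv_lhs => rw [h]
    simp
  refine Basis.ext_alternating e fun i hi => ?_
  let σ : Equiv.Perm ι := Equiv.ofBijective i (Finite.injective_iff_bijective.1 hi)
  change f (e ∘ σ) = LinearMap.toSpanSingleton R N (f e) (e.det (e ∘ σ))
  rw [AlternatingMap.map_perm, AlternatingMap.map_perm, Basis.det_self]
  simp [Units.smul_def, Int.cast_smul_eq_zsmul]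

/-- Solution of a banded linear system: `x (a + c)` is determined by the `a`-th equation
`∑ i ≤ c, K a i * x (a + i) = d a`. -/
noncomputable def bandedSolution (c : ℕ) (K : ℕ → ℕ → ℝ) (d : ℕ → ℝ) (k : ℕ) : ℝ :=
  if _h : k < c then 0
  else (d (k - c) - ∑ i : Fin c, K (k - c) i * bandedSolution c K d (k - c + i)) / K (k - c) c
termination_by k
decreasing_by have := i.2; omega

lemma sum_mul_bandedSolution (c : ℕ) (K : ℕ → ℕ → ℝ) (d : ℕ → ℝ) (a : ℕ) (hK : K a c ≠ 0) :
    ∑ i : Fin (c + 1), K a i * bandedSolution c K d (a + i) = d a := by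
  rw [Fin.sum_univ_castSucc]
  have : bandedSolution c K d (a + c) =
      (d a - ∑ i : Fin c, K a i * bandedSolution c K d (a + i)) / K a c := by
    rw [bandedSolution]
    simp
  simp only [Fin.val_castSucc, Fin.val_last, this]
  field_simp
  ring

/-- There is an array of reals whose initial-column solid minors are prescribed. -/
lemma exists_solid_minors (D : ℕ → ℕ → ℝ) (hD : ∀ a c, D a c ≠ 0) (hD0 : ∀ a, D a 0 = 1) (N : ℕ) :
    ∃ M : ℕ → ℕ → ℝ, ∀ c ≤ N, ∀ a,
      (Matrix.of fun i j : Fin c => M (a + i) j).det = D a c := by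
  induction N with
  | zero =>
    refine ⟨fun _ _ => 0, fun c hc a => ?_⟩
    obtain rfl : c = 0 := by omega
    simp [hD0]
  | succ N ih =>
    obtain ⟨M, hM⟩ := ih
    let K : ℕ → ℕ → ℝ := fun a k =>
      if h : k < N + 1 then (-1) ^ (k + N) *
        (Matrix.of fun i j : Fin N => M (a + (⟨k, h⟩ : Fin (N + 1)).succAbove i) j).det else 0
    let x := bandedSolution N K (fun a => D a (N + 1))
    refine ⟨fun i j => if j < N then M i j else x i, fun c hc a => ?_⟩
    rcases Nat.lt_or_ge c (N + 1) with h | h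
    · rw [← hM c (by omega) a]
      congr 1
      ext i j
      have : (j : ℕ) < N := by omega
      simp [this]
    · obtain rfl : c = N + 1 := by omega
      have hK : K a N = D a N := by
        rw [← hM N le_rfl a]
        simp only [K, lt_add_iff_pos_right, zero_lt_one, dif_pos]
        rw [← two_mul, pow_mul]
        simp only [even_two, Even.neg_pow, one_pow, one_mul]
        congr 1
        ext i j
        have : (⟨N, Nat.lt_succ_self N⟩ : Fin (N + 1)) = Fin.last N := rfl
        simp [this]
      rw [← sum_mul_bandedSolution N K (fun a => D a (N + 1)) a (hK ▸ hD a N),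
        Matrix.det_succ_column _ (Fin.last N)]
      refine Finset.sum_congr rfl fun i _ => ?_
      have hi : (i : ℕ) < N + 1 := i.2
      simp only [K, dif_pos hi, Matrix.of_apply, Fin.val_last, lt_irrefl, if_false, x]
      rw [mul_right_comm]
      congr 2
      congr 1
      ext k l
      simp

/-- Layers of a two-dimensional array whose hexagonal ratios are prescribed. -/
def hexPotential {A : Type*} [CommGroup A] (q : ℕ → A) (τ : ℕ → ℕ → A) : ℕ → ℕ → A
  | 0 => q
  | 1 => fun _ => 1
  | c + 2 => fun a => ∏ i ∈ Finset.range a,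
      (τ (i + 1) (c + 1) * hexPotential q τ c (i + 1) / hexPotential q τ c (i + 2) *
        hexPotential q τ (c + 1) (i + 2) / hexPotential q τ (c + 1) i)

lemma hexPotential_ratio {A : Type*} [CommGroup A] (q : ℕ → A) (τ : ℕ → ℕ → A) (a c : ℕ) :
    hexPotential q τ c (a + 2) / hexPotential q τ (c + 2) a *
      (hexPotential q τ (c + 2) (a + 1) / hexPotential q τ c (a + 1)) *
      (hexPotential q τ (c + 1) a / hexPotential q τ (c + 1) (a + 2)) = τ (a + 1) (c + 1) := by
  have h : hexPotential q τ (c + 2) (a + 1) = hexPotential q τ (c + 2) a *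
      (τ (a + 1) (c + 1) * hexPotential q τ c (a + 1) / hexPotential q τ c (a + 2) *
        hexPotential q τ (c + 1) (a + 2) / hexPotential q τ (c + 1) a) :=
    Finset.prod_range_succ _ _
  rw [h]
  simp only [div_eq_mul_inv]
  generalize hexPotential q τ (c + 2) a = x
  generalize hexPotential q τ c (a + 1) = y
  generalize hexPotential q τ c (a + 2) = z
  generalize hexPotential q τ (c + 1) a = u
  generalize hexPotential q τ (c + 1) (a + 2) = v
  calc _ = (τ (a + 1) (c + 1)) * (z * z⁻¹) * (x * x⁻¹) * (y * y⁻¹) * (u * u⁻¹) * (v * v⁻¹) := by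
        ac_rfl
    _ = _ := by simp

/-- The flag spanned by the initial segments of a sequence of vectors. -/
def FlagRn.ofSeq {n : ℕ} (s : ℕ → Fin n → ℝ) (hs : LinearIndependent ℝ fun i : Fin n => s i) :
    FlagRn n where
  space k := Submodule.span ℝ (Set.range fun i : Fin k => s i)
  mono a b hab _ := Submodule.span_mono <| by
    rintro _ ⟨i, rfl⟩
    exact ⟨Fin.castLE hab i, rfl⟩
  finrank_eq a ha := by
    exact (finrank_span_eq_card (hs.comp (Fin.castLE ha) (Fin.castLE_injective ha))).trans
      (Fintype.card_fin a)

/-- The chosen generator of `Λᵏ(Eᵏ)` is a nonzero multiple of the wedge product of any basis. -/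
lemma exists_flagWedge_eq_smul {n : ℕ} (E : FlagRn n) {k : ℕ} (hk : k ≤ n)
    (u : Fin k → Fin n → ℝ) (huE : ∀ i, u i ∈ E.space k) (hu : LinearIndependent ℝ u) :
    ∃ r : ℝ, r ≠ 0 ∧ flagWedge E k = r • wedge u := by
  have hex : ∃ v : Fin k → (Fin n → ℝ), (∀ i, v i ∈ E.space k) ∧ LinearIndependent ℝ v :=
    ⟨u, huE, hu⟩
  have hcard : Fintype.card (Fin k) = finrank ℝ (E.space k) := by
    rw [E.finrank_eq k hk, Fintype.card_fin]
  have basis (w : Fin k → Fin n → ℝ) (hwE : ∀ i, w i ∈ E.space k) (hw : LinearIndependent ℝ w) :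
      LinearIndependent ℝ (fun i => (⟨w i, hwE i⟩ : E.space k)) ∧
        Submodule.span ℝ (Set.range fun i => (⟨w i, hwE i⟩ : E.space k)) = ⊤ := by
    have h : LinearIndependent ℝ (fun i => (⟨w i, hwE i⟩ : E.space k)) :=
      LinearIndependent.of_comp (E.space k).subtype hw
    exact ⟨h, h.span_eq_top_of_card_eq_finrank' hcard⟩
  obtain ⟨hvE, hv⟩ := hex.choose_spec
  obtain ⟨hu1, hu2⟩ := basis u huE hu
  let b := Basis.mk hu1 hu2.ge
  refine ⟨b.det fun i => ⟨hex.choose i, hvE i⟩,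
    ((Basis.is_basis_iff_det b).1 (basis _ hvE hv)).ne_zero, ?_⟩
  have := AlternatingMap.apply_eq_basis_det_smul b
    ((ExteriorAlgebra.ιMulti ℝ k).compLinearMap (E.space k).subtype)
    fun i => ⟨hex.choose i, hvE i⟩
  rw [flagWedge, dif_pos hex]
  simpa [wedge, AlternatingMap.compLinearMap_apply, ExteriorAlgebra.ιMulti_apply, b] using this

lemma topRatio_smul_smul {n : ℕ} {z : ExteriorAlgebra ℝ (Fin n → ℝ)} (hz : z ≠ 0) (r s : ℝ)
    (hs : s ≠ 0) : topRatio (r • z) (s • z) = r / s := by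
  have h : ∃ q : ℝ, r • z = q • s • z := ⟨r / s, by rw [smul_smul, div_mul_cancel₀ _ hs]⟩
  rw [topRatio, dif_pos h]
  have := h.choose_spec
  rw [smul_smul] at this
  exact (eq_div_iff hs).2 (smul_left_injective ℝ hz this).symm

/-- A generator of `Λⁿ(ℝⁿ)`. -/
noncomputable def volumeForm (n : ℕ) : ExteriorAlgebra ℝ (Fin n → ℝ) :=
  ExteriorAlgebra.ιMulti ℝ n (Pi.basisFun ℝ (Fin n))

lemma volumeForm_ne_zero (n : ℕ) : volumeForm n ≠ 0 := by
  intro h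
  let f : ∀ i, (Fin n → ℝ) [⋀^Fin i]→ₗ[ℝ] ℝ := fun i =>
    if h : i = n then h ▸ (Pi.basisFun ℝ (Fin n)).det else 0
  have := ExteriorAlgebra.liftAlternating_apply_ιMulti f (Pi.basisFun ℝ (Fin n))
  have hf : f n = (Pi.basisFun ℝ (Fin n)).det := by simp only [f, dif_pos]
  rw [← volumeForm, h, map_zero, hf, Basis.det_self] at this
  exact zero_ne_one this

lemma wedge_mul_wedge {n a b : ℕ} (u : Fin a → Fin n → ℝ) (v : Fin b → Fin n → ℝ) :
    wedge u * wedge v = wedge (Fin.append u v) := by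
  simp only [wedge]
  rw [← List.prod_append, ← List.ofFn_fin_append]
  congr 2
  ext i
  refine Fin.addCases (fun i => ?_) (fun i => ?_) i <;> simp

lemma wedge_eq_det_smul {n : ℕ} (w : Fin n → Fin n → ℝ) :
    wedge w = (Matrix.of w).det • volumeForm n := by
  have := AlternatingMap.apply_eq_basis_det_smul (Pi.basisFun ℝ (Fin n))
    (ExteriorAlgebra.ιMulti ℝ n) w
  rwa [Pi.basisFun_det] at this

/-- The coordinate vectors of `ℝⁿ` in increasing order. -/
def ascVec (n i : ℕ) : Fin n → ℝ := fun k => if (k : ℕ) = i then 1 else 0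

/-- The coordinate vectors of `ℝⁿ` in decreasing order. -/
def descVec (n i : ℕ) : Fin n → ℝ := fun k => if (k : ℕ) + i + 1 = n then 1 else 0

/-- The columns of an array, truncated to `ℝⁿ`. -/
def colVec (n : ℕ) (M : ℕ → ℕ → ℝ) (j : ℕ) : Fin n → ℝ := fun k => M k j

/-- The coordinates `0, …, a - 1`, then the last `b` in decreasing order, then the middle ones. -/
noncomputable def blockEquiv (a b c : ℕ) : (Fin a ⊕ Fin b) ⊕ Fin c ≃ Fin (a + b + c) :=
  Equiv.ofBijective
    (Sum.elim (Sum.elim (fun i => ⟨i, by omega⟩) (fun i => ⟨a + b + c - 1 - i, by omega⟩))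
      (fun i => ⟨a + i, by omega⟩))
    ((Fintype.bijective_iff_injective_and_card _).2 ⟨by
      rintro ((i | i) | i) ((j | j) | j) h <;> simp [Fin.ext_iff] at h ⊢ <;> omega, by simp⟩)

lemma det_append_asc_desc (a b c : ℕ) (M : ℕ → ℕ → ℝ) :
    (Matrix.of (Fin.append (Fin.append (fun i : Fin a => ascVec (a + b + c) i)
      (fun i : Fin b => descVec (a + b + c) i)) (fun i : Fin c => colVec (a + b + c) M i))).det =
    (Equiv.Perm.sign ((blockEquiv a b c).symm.trans
      ((finSumFinEquiv.sumCongr (Equiv.refl (Fin c))).trans finSumFinEquiv)) : ℤ) *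
      (Matrix.of fun i j : Fin c => M (a + i) j).det := by
  set φ := (finSumFinEquiv.sumCongr (Equiv.refl (Fin c))).trans
    (finSumFinEquiv (m := a + b) (n := c))
  set ψ := blockEquiv a b c
  set W := Matrix.of (Fin.append (Fin.append (fun i : Fin a => ascVec (a + b + c) i)
      (fun i : Fin b => descVec (a + b + c) i)) (fun i : Fin c => colVec (a + b + c) M i))
  have hblock : W.submatrix φ ψ = Matrix.fromBlocks 1 0
      (W.submatrix φ ψ).toBlocks₂₁ (Matrix.of fun i j : Fin c => M (a + i) j).transpose := by
    ext i j
    rcases i with (i | i) | i <;> rcases j with (j | j) | j <;>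
      simp [W, φ, ψ, blockEquiv, ascVec, descVec, colVec, Matrix.one_apply, Fin.ext_iff,
        Matrix.toBlocks₂₁] <;>
      first | omega | exact if_congr (by omega) rfl rfl
  have h1 : (W.submatrix φ ψ).det = (Matrix.of fun i j : Fin c => M (a + i) j).det := by
    rw [hblock, Matrix.det_fromBlocks_zero₁₂, Matrix.det_one, one_mul, Matrix.det_transpose]
  have h2 : W.submatrix φ ψ = (W.submatrix (ψ.symm.trans φ) id).submatrix ψ ψ := by
    ext i j
    simp
  rw [h2, Matrix.det_submatrix_equiv_self, Matrix.det_permute] at h1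
  rw [← h1, ← mul_assoc, ← Int.cast_mul, ← Units.val_mul, Int.units_mul_self]
  simp

lemma linearIndependent_sumElim_of_det_append {a b c : ℕ} (u : Fin a → Fin (a + b + c) → ℝ)
    (v : Fin b → Fin (a + b + c) → ℝ) (w : Fin c → Fin (a + b + c) → ℝ)
    (h : (Matrix.of (Fin.append (Fin.append u v) w)).det ≠ 0) :
    LinearIndependent ℝ (Sum.elim (Sum.elim u v) w) := by
  have hW : LinearIndependent ℝ (Fin.append (Fin.append u v) w) :=
    Matrix.linearIndependent_rows_of_det_ne_zero h
  convert hW.comp _ ((finSumFinEquiv.sumCongr (Equiv.refl (Fin c))).trans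
    finSumFinEquiv).injective using 1
  ext i
  rcases i with (i | i) | i <;> simp

/-- Up to a sign depending only on the block sizes, the volume of an ascending, a descending and
an arbitrary block of vectors is a solid minor. -/
lemma exists_sign_wedge (n a b c : ℕ) : ∃ σ : ℝˣ, a + b + c = n → ∀ M : ℕ → ℕ → ℝ,
    wedge (fun i : Fin a => ascVec n i) * wedge (fun i : Fin b => descVec n i) *
        wedge (fun i : Fin c => colVec n M i) =
      (σ * (Matrix.of fun i j : Fin c => M (a + i) j).det) • volumeForm n ∧
    ((Matrix.of fun i j : Fin c => M (a + i) j).det ≠ 0 →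
      LinearIndependent ℝ (Sum.elim (Sum.elim (fun i : Fin a => ascVec n i)
        (fun i : Fin b => descVec n i)) (fun i : Fin c => colVec n M i))) := by
  by_cases hn : a + b + c = n
  swap
  · exact ⟨1, fun h => absurd h hn⟩
  subst hn
  refine ⟨Units.map (Int.castRingHom ℝ).toMonoidHom (Equiv.Perm.sign ((blockEquiv a b c).symm.trans
      ((finSumFinEquiv.sumCongr (Equiv.refl (Fin c))).trans finSumFinEquiv))), fun _ M => ?_⟩
  have hdet := det_append_asc_desc a b c M
  refine ⟨?_, fun hne => ?_⟩
  · rw [wedge_mul_wedge, wedge_mul_wedge, wedge_eq_det_smul, hdet]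
    rfl
  · apply linearIndependent_sumElim_of_det_append
    rw [hdet]
    refine mul_ne_zero ?_ hne
    exact_mod_cast Units.ne_zero _

/-- For any family of nonzero reals `t_{abc}` indexed by `a, b, c ≥ 1`
with `a + b + c = n`, there is a generic flag triple `(E,F,G)` in `ℝⁿ` with
`T_{abc}(E,F,G) = t_{abc}` for all such `a, b, c`. -/
theorem stmt_9 (n : ℕ) (t : ℕ → ℕ → ℕ → ℝ)
    (ht : ∀ a b c : ℕ, 1 ≤ a → 1 ≤ b → 1 ≤ c → a + b + c = n → t a b c ≠ 0) :
    ∃ E F G : FlagRn n, GenericTriple n E F G ∧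
      ∀ a b c : ℕ, 1 ≤ a → 1 ≤ b → 1 ≤ c → a + b + c = n →
        tripleRatio a b c E F G = t a b c := by
  choose σ hσ using exists_sign_wedge n
  let τ : ℕ → ℕ → ℝˣ := fun a c =>
    open Classical in if h : t a (n - a - c) c = 0 then 1 else Units.mk0 _ h
  let Q : ℕ → ℕ → ℝˣ := hexPotential (fun a => σ a (n - a) 0) τ
  obtain ⟨M, hM⟩ := exists_solid_minors (fun a c => ((Q c a / σ a (n - a - c) c : ℝˣ) : ℝ))
    (fun a c => Units.ne_zero _) (fun a => by simp [Q, hexPotential]) n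
  have hdet (a b c : ℕ) (h : a + b + c = n) :
      (Matrix.of fun i j : Fin c => M (a + i) j).det = ((Q c a / σ a b c : ℝˣ) : ℝ) := by
    obtain rfl : b = n - a - c := by omega
    exact hM c (by omega) a
  have hwedge (a b c : ℕ) (h : a + b + c = n) :
      wedge (fun i : Fin a => ascVec n i) * wedge (fun i : Fin b => descVec n i) *
        wedge (fun i : Fin c => colVec n M i) = (Q c a : ℝ) • volumeForm n := by
    rw [(hσ a b c h M).1, hdet a b c h, ← Units.val_mul, mul_div_cancel]
  have hli (a b c : ℕ) (h : a + b + c = n) :=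
    (hσ a b c h M).2 (by rw [hdet a b c h]; exact Units.ne_zero _)
  have hE : LinearIndependent ℝ fun i : Fin n => ascVec n i :=
    (linearIndependent_sum.1 (linearIndependent_sum.1 (hli n 0 0 (by simp))).1).1
  have hF : LinearIndependent ℝ fun i : Fin n => descVec n i :=
    (linearIndependent_sum.1 (linearIndependent_sum.1 (hli 0 n 0 (by simp))).1).2.1
  have hG : LinearIndependent ℝ fun i : Fin n => colVec n M i :=
    (linearIndependent_sum.1 (hli 0 0 n (by simp))).2.1
  have hEF (a b c : ℕ) (h : a + b + c = n) :
      (FlagRn.ofSeq _ hE).space a ⊓ (FlagRn.ofSeq _ hF).space b = ⊥ :=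
    (linearIndependent_sum.1 (linearIndependent_sum.1 (hli a b c h)).1).2.2.eq_bot
  refine ⟨FlagRn.ofSeq _ hE, FlagRn.ofSeq _ hF, FlagRn.ofSeq _ hG,
    ⟨fun a ha => ?_, fun a ha => ?_, fun a ha => ?_, fun a b c h => ?_⟩,
    fun a b c ha hb hc h => ?_⟩
  · exact hEF a (n - a) 0 (by omega)
  · refine ((linearIndependent_sum.1 (hli 0 a (n - a) (by omega))).2.2.mono_left
      (Submodule.span_mono ?_)).eq_bot
    rintro _ ⟨i, rfl⟩
    exact ⟨Sum.inr i, rfl⟩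
  · refine ((linearIndependent_sum.1 (hli a 0 (n - a) (by omega))).2.2.mono_left
      (Submodule.span_mono ?_)).eq_bot
    rintro _ ⟨i, rfl⟩
    exact ⟨Sum.inl i, rfl⟩
  · rw [hEF a b c h, bot_inf_eq]
  · have key (s : ℕ → Fin n → ℝ) (hs : LinearIndependent ℝ fun i : Fin n => s i) (k : ℕ) :
        ∃ r : ℝ, k ≤ n → r ≠ 0 ∧
          flagWedge (FlagRn.ofSeq s hs) k = r • wedge (fun i : Fin k => s i) := by
      by_cases hk : k ≤ n
      · obtain ⟨r, hr⟩ := exists_flagWedge_eq_smul (FlagRn.ofSeq s hs) hk (fun i => s i)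
          (fun i => Submodule.subset_span ⟨i, rfl⟩)
          (hs.comp (Fin.castLE hk) (Fin.castLE_injective hk))
        exact ⟨r, fun _ => hr⟩
      · exact ⟨0, fun h => absurd h hk⟩
    choose x hx using key _ hE
    choose y hy using key _ hF
    choose z hz using key _ hG
    have hprod (a b c : ℕ) (h : a + b + c = n) :
        flagWedge (FlagRn.ofSeq _ hE) a * flagWedge (FlagRn.ofSeq _ hF) b *
          flagWedge (FlagRn.ofSeq _ hG) c = (x a * y b * z c * Q c a) • volumeForm n := by
      rw [(hx a (by omega)).2, (hy b (by omega)).2, (hz c (by omega)).2]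
      simp only [smul_mul_assoc, mul_smul_comm, hwedge a b c h, smul_smul]
      congr 1
      ring
    have hratio (a b c a' b' c' : ℕ) (h : a + b + c = n) (h' : a' + b' + c' = n) :
        topRatio (flagWedge (FlagRn.ofSeq _ hE) a * flagWedge (FlagRn.ofSeq _ hF) b *
            flagWedge (FlagRn.ofSeq _ hG) c)
          (flagWedge (FlagRn.ofSeq _ hE) a' * flagWedge (FlagRn.ofSeq _ hF) b' *
            flagWedge (FlagRn.ofSeq _ hG) c') =
        (x a * y b * z c * Q c a) / (x a' * y b' * z c' * Q c' a') := by
      rw [hprod a b c h, hprod a' b' c' h', topRatio_smul_smul (volumeForm_ne_zero n)]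
      have h1 := (hx a' (by omega)).1
      have h2 := (hy b' (by omega)).1
      have h3 := (hz c' (by omega)).1
      have h4 := (Q c' a').ne_zero
      positivity
    obtain ⟨a, rfl⟩ := Nat.exists_eq_add_of_le' ha
    obtain ⟨b, rfl⟩ := Nat.exists_eq_add_of_le' hb
    obtain ⟨c, rfl⟩ := Nat.exists_eq_add_of_le' hc
    have hQ := congrArg Units.val (hexPotential_ratio (fun a => σ a (n - a) 0) τ a c)
    have hτ : (τ (a + 1) (c + 1) : ℝ) = t (a + 1) (b + 1) (c + 1) := by
      have hb' : n - (a + 1) - (c + 1) = b + 1 := by omega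
      have := ht _ _ _ ha hb hc h
      simp [τ, hb', this]
    rw [hτ] at hQ
    rw [← hQ, tripleRatio]
    simp only [Nat.add_sub_cancel, add_assoc, Nat.reduceAdd]
    rw [hratio _ _ _ _ _ _ (by omega) (by omega), hratio _ _ _ _ _ _ (by omega) (by omega),
      hratio _ _ _ _ _ _ (by omega) (by omega)]
    have x0 := (hx a (by omega)).1
    have x1 := (hx (a + 1) (by omega)).1
    have x2 := (hx (a + 2) (by omega)).1
    have y0 := (hy b (by omega)).1
    have y1 := (hy (b + 1) (by omega)).1
    have y2 := (hy (b + 2) (by omega)).1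
    have z0 := (hz c (by omega)).1
    have z1 := (hz (c + 1) (by omega)).1
    have z2 := (hz (c + 2) (by omega)).1
    simp only [Units.val_mul, Units.val_div_eq_div_val]
    change _ = (Q c (a + 2) : ℝ) / Q (c + 2) a * (Q (c + 2) (a + 1) / Q c (a + 1)) *
      (Q (c + 1) a / Q (c + 1) (a + 2))
    field_simp
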